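/- Let U be a finite-memory scheduler of an NPLCS N and q a location. (a) For any location p and mode u of U, if T denotes the set of states of the Markov chain MC_U reachable from the state (p,ε)_u, then Pr_U((q,ε) ⊨ □◇(p,ε)_u) = Pr_U((q,ε) ⊨ ⋀_{t∈T} □◇t). (b) For any set of locations A ⊆ Q, Pr_U((q,ε) ⊨ □◇A) = Pr_U((q,ε) ⊨ □◇A_ε), where A_ε = {(a,ε) : a ∈ A}. -/

import Mathlib

open scoped ENNReal
open Classical

namespace NPLCSmodel

/-! ## Lossy channel systems -/

/-- Operations of a lossy channel system: send a message on a channel,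
receive a message from a channel, or an internal action. -/
inductive LcsOp (C M : Type) : Type where
  | send : C → M → LcsOp C M
  | recv : C → M → LcsOp C M
  | internal : LcsOp C M

def LcsOp.IsRecv {C M : Type} : LcsOp C M → Prop
  | .recv _ _ => True
  | _ => False

/-- A transition rule `src --op--> dst`. -/
structure LcsRule (Q C M : Type) : Type where
  src : Q
  op : LcsOp C M
  dst : Q

/-- Channel contents: a word over `M` for each channel. -/
abbrev Chans (C M : Type) : Type := C → List M

/-- Configurations: a location together with channel contents. -/
abbrev Conf (Q C M : Type) : Type := Q × Chans C M

/-- The empty channel contents ε. -/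
def eps (C M : Type) : Chans C M := fun _ => []

variable {Q C M : Type}

/-- When is an operation possible on channel contents `w`? -/
def enabledOp : LcsOp C M → Chans C M → Prop
  | .recv c m, w => ∃ v, w c = m :: v
  | .send _ _, _ => True
  | .internal, _ => True

/-- Effect of an operation on the channel contents (for a perfect step). -/
def applyOp [DecidableEq C] : LcsOp C M → Chans C M → Chans C M
  | .send c m, w => Function.update w c (w c ++ [m])
  | .recv c _, w => Function.update w c (w c).tail
  | .internal, w => w

/-- A rule is enabled in a configuration. -/
def LcsRule.EnabledIn (δ : LcsRule Q C M) (s : Conf Q C M) : Prop :=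
  δ.src = s.1 ∧ enabledOp δ.op s.2

/-- A lossy channel system `L = (Q, C, M, Δ)` (the finiteness of the location,
channel and message types is imposed by `Fintype` assumptions at use sites):
a finite set of transition rules such that every location has at least one
outgoing rule that is not a receive. -/
structure LCS (Q C M : Type) : Type where
  rules : Set (LcsRule Q C M)
  finiteRules : rules.Finite
  noDeadlock : ∀ q : Q, ∃ δ ∈ rules, δ.src = q ∧ ¬ δ.op.IsRecv

variable [DecidableEq C]

/-- Lossy step via rule `δ`: a perfect step followed by losing arbitrarily
many messages (`<+` is the (componentwise) subword relation). -/
def LCS.StepVia (L : LCS Q C M) (s : Conf Q C M) (δ : LcsRule Q C M)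
    (t : Conf Q C M) : Prop :=
  δ ∈ L.rules ∧ δ.EnabledIn s ∧ t.1 = δ.dst ∧ ∀ c, List.Sublist (t.2 c) (applyOp δ.op s.2 c)

/-- Lossy step `s → t`. -/
def LCS.Step (L : LCS Q C M) (s t : Conf Q C M) : Prop := ∃ δ, L.StepVia s δ t

/-- Reachability `s →* t`. -/
def LCS.Reach (L : LCS Q C M) : Conf Q C M → Conf Q C M → Prop :=
  Relation.ReflTransGen L.Step

/-- Constrained reachability `s →*_[X) t`: all configurations along the path,
except possibly the last one, have their location in `X`. -/
def LCS.ReachWithin (L : LCS Q C M) (X : Set Q) : Conf Q C M → Conf Q C M → Prop :=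
  Relation.ReflTransGen (fun a b => L.Step a b ∧ a.1 ∈ X)

/-- Constrained reachability `s →*_[X] t`: all configurations along the path,
including `s` and `t`, have their location in `X`. -/
def LCS.ReachConstrained (L : LCS Q C M) (X : Set Q) (s t : Conf Q C M) : Prop :=
  L.ReachWithin X s t ∧ t.1 ∈ X

/-- `X` is safe for `A`. -/
def LCS.IsSafeFor (L : LCS Q C M) (A X : Set Q) : Prop :=
  X ⊆ A ∧ ∀ x ∈ X, ∃ t, L.Step (x, eps C M) t ∧ t.1 ∈ X

/-- `Safe(A)`: the largest set safe for `A` (the union of all such sets). -/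
def LCS.Safe (L : LCS Q C M) (A : Set Q) : Set Q := ⋃₀ {X | L.IsSafeFor A X}

/-- `X` is promising for `A`. -/
def LCS.IsPromisingFor (L : LCS Q C M) (A X : Set Q) : Prop :=
  ∀ x ∈ X, ∃ t, L.ReachWithin X (x, eps C M) t ∧ t.1 ∈ A

/-- `Prom(A)`: the largest set promising for `A` (the union of all such sets). -/
def LCS.Prom (L : LCS Q C M) (A : Set Q) : Set Q := ⋃₀ {X | L.IsPromisingFor A X}

/-! ## NPLCS and the induced Markov decision process -/

/-- An NPLCS: an LCS together with a fault rate `τ ∈ (0,1)`. -/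
structure NPLCS (Q C M : Type) : Type where
  L : LCS Q C M
  τ : ℝ
  τ_pos : 0 < τ
  τ_lt_one : τ < 1

/-- The number of embeddings of the second list as a subword of the first. -/
def countEmb [DecidableEq M] : List M → List M → ℕ
  | _, [] => 1
  | [], _ :: _ => 0
  | a :: v, b :: w => (if a = b then countEmb v w else 0) + countEmb v (b :: w)

variable [Fintype C] [DecidableEq M]

/-- Total number of messages in the channels. -/
def chansSize (w : Chans C M) : ℕ := ∑ c, (w c).length

/-- `P_lost(v,v') = τ^(|v|-|v'|) · (1-τ)^|v'| · C(v,v')`, the probability that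
channel contents `v` become `v'` through message losses. -/
noncomputable def plost (τ : ℝ) (v v' : Chans C M) : ℝ≥0∞ :=
  ENNReal.ofReal
    (τ ^ (chansSize v - chansSize v') * (1 - τ) ^ chansSize v' *
      (∏ c, countEmb (v c) (v' c) : ℕ))

/-- One-step probability `P_N(s, δ, t)` of the MDP of an NPLCS. -/
noncomputable def NPLCS.stepProb (N : NPLCS Q C M) (s : Conf Q C M)
    (δ : LcsRule Q C M) (t : Conf Q C M) : ℝ≥0∞ :=
  if δ ∈ N.L.rules ∧ δ.EnabledIn s ∧ t.1 = δ.dst then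
    plost N.τ (applyOp δ.op s.2) t.2
  else 0

/-! ## Probability measure of a countable-state Markov chain

Given one-step probabilities `k` on a state space `S`, the measure of a set of
trajectories is the Carathéodory outer measure generated by the probabilities
of cylinder sets; it agrees with the usual Markov-chain measure on all
measurable (in particular, on all ω-regular) sets of trajectories. -/

section Chain
variable {S : Type}

/-- Probability that the chain starting in `s` performs the finite sequence
of steps through the configurations listed in `l`. -/
noncomputable def chainPathProb (k : S → S → ℝ≥0∞) : S → List S → ℝ≥0∞
  | _, [] => 1
  | s, t :: l => k s t * chainPathProb k t l

/-- The cylinder of trajectories starting with `s` followed by `l`. -/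
def chainCyl (s : S) (l : List S) : Set (ℕ → S) :=
  {ω | ω 0 = s ∧ ∀ (i : ℕ) (h : i < l.length), ω (i + 1) = l.get ⟨i, h⟩}

/-- Premeasure: probability of a cylinder set, `∞` on other (nonempty) sets. -/
noncomputable def chainFun (k : S → S → ℝ≥0∞) (s : S) (A : Set (ℕ → S)) : ℝ≥0∞ :=
  if A = ∅ then 0 else ⨅ (l : List S) (_ : A = chainCyl s l), chainPathProb k s l

theorem chainFun_empty (k : S → S → ℝ≥0∞) (s : S) : chainFun k s ∅ = 0 := by
  simp [chainFun]

/-- The probability, for the Markov chain with one-step probabilities `k`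
started in `s`, of the set `E` of trajectories (paths starting in `s`). -/
noncomputable def chainPr (k : S → S → ℝ≥0∞) (s : S) (E : Set (ℕ → S)) : ℝ≥0∞ :=
  MeasureTheory.OuterMeasure.ofFunction (chainFun k s) (chainFun_empty k s)
    (E ∩ {ω | ω 0 = s})

end Chain

/-! ## Schedulers -/

/-- A (history-dependent, deterministic) scheduler: given the history
`h = s₁ → ⋯ → s_{n-1}` and the current configuration `sₙ`, it chooses a
transition rule of `N` enabled in `sₙ`. -/
structure Scheduler (N : NPLCS Q C M) : Type where
  choose : List (Conf Q C M) → Conf Q C M → LcsRule Q C M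
  choose_mem : ∀ h s, choose h s ∈ N.L.rules
  choose_enabled : ∀ h s, (choose h s).EnabledIn s

variable {N : NPLCS Q C M}

/-- The Markov chain `MC_U` induced by a scheduler: its states are finite
paths, represented as (history, current configuration). -/
noncomputable def Scheduler.kernel (U : Scheduler N) :
    List (Conf Q C M) × Conf Q C M → List (Conf Q C M) × Conf Q C M → ℝ≥0∞ :=
  fun a b =>
    if b.1 = a.1 ++ [a.2] then N.stepProb a.2 (U.choose a.1 a.2) b.2 else 0

/-- `Pr_U(s ⊨ E)`: the probability, under scheduler `U` with starting
configuration `s`, of the set `E` of infinite paths (trajectories of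
configurations). -/
noncomputable def Scheduler.Pr (U : Scheduler N) (s : Conf Q C M)
    (E : Set (ℕ → Conf Q C M)) : ℝ≥0∞ :=
  chainPr U.kernel ([], s) {ω | (fun i => (ω i).2) ∈ E}

/-- Memoryless scheduler: the decision depends only on the current
configuration. -/
def Scheduler.Memoryless (U : Scheduler N) : Prop :=
  ∀ h h' s, U.choose h s = U.choose h' s

/-- Blind scheduler: the decision depends only on the sequence of locations
that have been visited. -/
def Scheduler.Blind (U : Scheduler N) : Prop :=
  ∀ h h' s s', h.map Prod.fst = h'.map Prod.fst → s.1 = s'.1 →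
    U.choose h s = U.choose h' s'

/-- Finite-memory scheduler data: finitely many modes, a starting mode, a
decision rule and a next-mode function. -/
structure FMScheduler (N : NPLCS Q C M) : Type 1 where
  Mode : Type
  modeFin : Fintype Mode
  init : Mode
  D : Mode → Conf Q C M → LcsRule Q C M
  upd : Mode → Conf Q C M → Mode
  D_mem : ∀ u s, D u s ∈ N.L.rules
  D_enabled : ∀ u s, (D u s).EnabledIn s

/-- A scheduler is finite-memory if it is induced by finite-memory data. -/
def Scheduler.FiniteMemory (U : Scheduler N) : Prop :=
  ∃ fm : FMScheduler N, ∀ h s, U.choose h s = fm.D (h.foldl fm.upd fm.init) s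

/-- The Markov chain `MC_U` of a finite-memory scheduler: states are pairs
`s_u` of a configuration `s` and a mode `u`. -/
noncomputable def FMScheduler.kernel (fm : FMScheduler N) :
    Conf Q C M × fm.Mode → Conf Q C M × fm.Mode → ℝ≥0∞ :=
  fun a b =>
    if b.2 = fm.upd a.2 a.1 then N.stepProb a.1 (fm.D a.2 a.1) b.1 else 0

/-- Probability measure of the Markov chain `MC_U` of a finite-memory
scheduler, over trajectories of (configuration, mode) states. -/
noncomputable def FMScheduler.PrMC (fm : FMScheduler N)
    (a : Conf Q C M × fm.Mode) (E : Set (ℕ → Conf Q C M × fm.Mode)) : ℝ≥0∞ :=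
  chainPr fm.kernel a E

/-- Reachability in the Markov chain `MC_U` of a finite-memory scheduler. -/
def FMScheduler.MCReach (fm : FMScheduler N) :
    Conf Q C M × fm.Mode → Conf Q C M × fm.Mode → Prop :=
  Relation.ReflTransGen (fun a b => 0 < fm.kernel a b)

/-- The history (the first `i` configurations) of a trajectory. -/
def histTo (ω : ℕ → Conf Q C M) (i : ℕ) : List (Conf Q C M) :=
  (List.range i).map ω

/-- Almost blind scheduler: there are a scheduler `W` and a blind scheduler
`V` such that from any starting configuration, almost surely the choices of
`U` along the path agree with those of `W` up to some finite time and with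
those of `V` afterwards. -/
def Scheduler.AlmostBlind (U : Scheduler N) : Prop :=
  ∃ W V : Scheduler N, V.Blind ∧ ∀ s : Conf Q C M,
    U.Pr s {ω | ∃ n : ℕ,
      (∀ i ≤ n, U.choose (histTo ω i) (ω i) = W.choose (histTo ω i) (ω i)) ∧
      (∀ i, n < i → U.choose (histTo ω i) (ω i) = V.choose (histTo ω i) (ω i))} = 1

/-! ## LTL-style events on trajectories -/

/-- `□P` -/
def evAlways {α : Type} (P : α → Prop) : Set (ℕ → α) := {ω | ∀ i, P (ω i)}

/-- `◇P` -/
def evEventually {α : Type} (P : α → Prop) : Set (ℕ → α) := {ω | ∃ i, P (ω i)}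

/-- `□◇P` -/
def evInfOften {α : Type} (P : α → Prop) : Set (ℕ → α) :=
  {ω | ∀ n, ∃ i, n ≤ i ∧ P (ω i)}

/-- `◇□P` -/
def evEvAlways {α : Type} (P : α → Prop) : Set (ℕ → α) :=
  {ω | ∃ n, ∀ i, n ≤ i → P (ω i)}

/-- The atomic proposition "the current location belongs to `A`". -/
def inLoc (A : Set Q) : Conf Q C M → Prop := fun s => s.1 ∈ A


section ChainLemmas

open MeasureTheory

variable {S : Type} {k : S → S → ℝ≥0∞}

/-- `chainPr` as an outer measure on trajectories. -/
noncomputable def chainOuter (k : S → S → ℝ≥0∞) (s : S) : OuterMeasure (ℕ → S) :=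
  OuterMeasure.restrict {ω | ω 0 = s}
    (OuterMeasure.ofFunction (chainFun k s) (chainFun_empty k s))

theorem chainOuter_apply (k : S → S → ℝ≥0∞) (s : S) (E : Set (ℕ → S)) :
    chainOuter k s E = chainPr k s E := by
  simp [chainOuter, chainPr]

theorem chainOuter_mono_of_start {s : S} {E F : Set (ℕ → S)}
    (h : ∀ ω, ω 0 = s → ω ∈ E → ω ∈ F) : chainOuter k s E ≤ chainOuter k s F := by
  simp only [chainOuter, OuterMeasure.restrict_apply]
  exact measure_mono fun ω hω => ⟨h ω hω.2 hω.1, hω.2⟩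

theorem chainOuter_null_of_start {s : S} {E : Set (ℕ → S)}
    (h : ∀ ω ∈ E, ω 0 ≠ s) : chainOuter k s E = 0 := by
  have := chainOuter_mono_of_start (k := k) (s := s) (E := E) (F := ∅)
    fun ω h0 hω => (h ω hω h0).elim
  simpa using this

theorem chainOuter_cyl_le (k : S → S → ℝ≥0∞) (s : S) (l : List S) :
    chainOuter k s (chainCyl s l) ≤ chainPathProb k s l := by
  simp only [chainOuter, OuterMeasure.restrict_apply]
  refine (measure_mono Set.inter_subset_left).trans ((OuterMeasure.ofFunction_le _).trans ?_)
  rw [chainFun]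
  split_ifs
  · exact zero_le
  · exact iInf_le_of_le l (iInf_le _ rfl)

theorem chainOuter_le_one (s : S) (E : Set (ℕ → S)) : chainOuter k s E ≤ 1 :=
  (chainOuter_mono_of_start fun ω h0 _ => by simpa [chainCyl] using h0).trans
    (chainOuter_cyl_le k s [])

/-- Prefixing a trajectory with a state. -/
def trajCons (s : S) (ω : ℕ → S) : ℕ → S
  | 0 => s
  | n + 1 => ω n

theorem trajCons_image_chainCyl (s t : S) (l : List S) :
    trajCons s '' chainCyl t l = chainCyl s (t :: l) := by
  ext ω
  constructor
  · rintro ⟨ω, ⟨h0, h⟩, rfl⟩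
    refine ⟨rfl, fun i hi => ?_⟩
    cases i with
    | zero => simpa [trajCons] using h0
    | succ i => simpa [trajCons] using h i (by simpa using hi)
  · rintro ⟨h0, h⟩
    refine ⟨fun i => ω (i + 1), ⟨?_, fun i hi => ?_⟩, ?_⟩
    · simpa using h 0 (by simp)
    · simpa using h (i + 1) (by simpa using hi)
    · funext n
      cases n with
      | zero => simp [trajCons, h0]
      | succ n => rfl

theorem chainOuter_cons_le {s t : S} (hfin : k s t ≠ ∞) (hpos : k s t ≠ 0)
    (E : Set (ℕ → S)) :
    chainOuter k s {ω | ω 1 = t ∧ (fun i => ω (i + 1)) ∈ E} ≤ k s t * chainOuter k t E := by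
  set O := OuterMeasure.ofFunction (chainFun k s) (chainFun_empty k s) with hO
  have key : OuterMeasure.comap (trajCons s) O ≤
      k s t • OuterMeasure.ofFunction (chainFun k t) (chainFun_empty k t) := by
    rw [OuterMeasure.smul_ofFunction hfin, OuterMeasure.le_ofFunction]
    intro F
    simp only [OuterMeasure.comap_apply, Pi.smul_apply, smul_eq_mul]
    rcases eq_or_ne F ∅ with rfl | hF
    · simp
    · rw [chainFun, if_neg hF, ENNReal.mul_iInf_of_ne hpos hfin]
      refine le_iInf fun l => ?_
      rw [ENNReal.mul_iInf_of_ne hpos hfin]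
      refine le_iInf fun hl => ?_
      rw [hl, trajCons_image_chainCyl]
      refine (OuterMeasure.ofFunction_le _).trans ?_
      rw [chainFun]
      split_ifs
      · exact zero_le
      · exact iInf_le_of_le (t :: l) (iInf_le _ rfl)
  have h := key (E ∩ {ω | ω 0 = t})
  simp only [OuterMeasure.comap_apply, _root_.smul_apply, smul_eq_mul] at h
  simp only [chainOuter, OuterMeasure.restrict_apply]
  refine le_trans (measure_mono ?_) h
  rintro ω ⟨⟨h1, hE⟩, h0⟩
  refine ⟨fun i => ω (i + 1), ⟨hE, h1⟩, ?_⟩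
  funext n
  cases n with
  | zero => exact h0.symm
  | succ n => rfl

theorem chainOuter_step_null {s t : S} (h : k s t = 0) :
    chainOuter k s {ω | ω 1 = t} = 0 := by
  refine le_antisymm ?_ zero_le
  refine (chainOuter_mono_of_start fun ω h0 h1 => ?_).trans
    ((chainOuter_cyl_le k s [t]).trans (by simp [chainPathProb, h]))
  refine ⟨h0, fun i hi => ?_⟩
  obtain rfl : i = 0 := by simpa using hi
  simpa using h1

theorem infOften_of_reach {ω : ℕ → S}
    (hω : ∀ x t, 0 < k x t → ω ∈ evInfOften (· = x) → ω ∈ evInfOften (· = t)) {x t : S}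
    (hx : ω ∈ evInfOften (· = x))
    (hxt : Relation.ReflTransGen (fun a b => 0 < k a b) x t) : ω ∈ evInfOften (· = t) := by
  induction hxt with
  | refl => exact hx
  | tail _ h ih => exact hω _ _ h ih

variable [Countable S]

theorem chainOuter_shift_le (hk : ∀ s, ∑' t, k s t ≤ 1) (s : S) (E : Set (ℕ → S)) :
    chainOuter k s {ω | (fun i => ω (i + 1)) ∈ E} ≤ ∑' t, k s t * chainOuter k t E := by
  have hsub : {ω : ℕ → S | (fun i => ω (i + 1)) ∈ E} ⊆
      ⋃ t, {ω | ω 1 = t ∧ (fun i => ω (i + 1)) ∈ E} := fun ω hω =>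
    Set.mem_iUnion.2 ⟨ω 1, rfl, hω⟩
  refine (measure_mono hsub).trans ((measure_iUnion_le _).trans ?_)
  refine ENNReal.tsum_le_tsum fun t => ?_
  by_cases h0 : k s t = 0
  · rw [h0, zero_mul, ← chainOuter_step_null h0]
    exact measure_mono fun ω hω => hω.1
  · have h1 : k s t ≤ 1 := (ENNReal.le_tsum t).trans (hk s)
    exact chainOuter_cons_le (ne_top_of_le_ne_top ENNReal.one_ne_top h1) h0 E

theorem chainOuter_shift_null (hk : ∀ s, ∑' t, k s t ≤ 1) {E : Set (ℕ → S)}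
    (hE : ∀ s, chainOuter k s E = 0) (m : ℕ) (s : S) :
    chainOuter k s {ω | (fun i => ω (i + m)) ∈ E} = 0 := by
  induction m generalizing s with
  | zero => exact hE s
  | succ m ih =>
    have h := chainOuter_shift_le hk s {ω | (fun i => ω (i + m)) ∈ E}
    simp only [ih, mul_zero, tsum_zero, nonpos_iff_eq_zero] at h
    exact h

theorem chainOuter_zero_step_null (hk : ∀ s, ∑' t, k s t ≤ 1) (s : S) :
    chainOuter k s {ω | ∃ i, k (ω i) (ω (i + 1)) = 0} = 0 := by
  have h0 : ∀ s, chainOuter k s {ω | k (ω 0) (ω 1) = 0} = 0 := by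
    intro s
    have hU : chainOuter k s (⋃ t : {t // k s t = 0}, {ω | ω 1 = t}) = 0 :=
      measure_iUnion_null fun t => chainOuter_step_null t.2
    refine le_antisymm ((chainOuter_mono_of_start fun ω hs hω => ?_).trans hU.le) zero_le
    subst hs
    exact Set.mem_iUnion.2 ⟨⟨ω 1, hω⟩, rfl⟩
  have : {ω : ℕ → S | ∃ i, k (ω i) (ω (i + 1)) = 0} =
      ⋃ m, {ω | (fun i => ω (i + m)) ∈ {ω : ℕ → S | k (ω 0) (ω 1) = 0}} := by
    ext ω
    simp [add_comm]
  rw [this]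
  exact measure_iUnion_null fun m => chainOuter_shift_null hk h0 m s

/-- A strong-Markov-type bound: an event that forces a visit to `x` and is stable under
shifts is at most as likely from any state as it is from `x`. -/
theorem chainOuter_le_of_visit (hk : ∀ s, ∑' t, k s t ≤ 1) {E : Set (ℕ → S)} {x : S}
    (hvisit : ∀ ω ∈ E, ∃ i, ω i = x) (hshift : ∀ ω ∈ E, (fun i => ω (i + 1)) ∈ E) (s : S) :
    chainOuter k s E ≤ chainOuter k x E := by
  set F : ℕ → Set (ℕ → S) := fun n => {ω | ω ∈ E ∧ (∀ i < n, ω i ≠ x) ∧ ω n = x} with hF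
  have hsum : ∀ N s, ∑ n ∈ Finset.range N, chainOuter k s (F n) ≤ chainOuter k x E := by
    intro N
    induction N with
    | zero => simp
    | succ N ih =>
      intro s
      rw [Finset.sum_range_succ']
      by_cases hs : s = x
      · subst hs
        have : ∀ n, chainOuter k s (F (n + 1)) = 0 := fun n =>
          chainOuter_null_of_start fun ω hω => hω.2.1 0 n.succ_pos
        simp only [this, Finset.sum_const_zero, zero_add]
        exact measure_mono fun ω hω => hω.1
      · have h0 : chainOuter k s (F 0) = 0 :=
          chainOuter_null_of_start fun ω hω h => hs (h.symm.trans hω.2.2)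
        rw [h0, add_zero]
        have hstep : ∀ n, chainOuter k s (F (n + 1)) ≤
            ∑' t, k s t * chainOuter k t (F n) := by
          intro n
          refine le_trans (measure_mono ?_) (chainOuter_shift_le hk s (F n))
          rintro ω ⟨hωE, hlt, hx⟩
          exact ⟨hshift ω hωE, fun i hi => hlt (i + 1) (Nat.succ_lt_succ hi), hx⟩
        calc ∑ n ∈ Finset.range N, chainOuter k s (F (n + 1))
            ≤ ∑ n ∈ Finset.range N, ∑' t, k s t * chainOuter k t (F n) :=
              Finset.sum_le_sum fun n _ => hstep n
          _ = ∑' t, k s t * ∑ n ∈ Finset.range N, chainOuter k t (F n) := by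
              rw [← Summable.tsum_finsetSum fun _ _ => ENNReal.summable]
              simp only [Finset.mul_sum]
          _ ≤ ∑' t, k s t * chainOuter k x E :=
              ENNReal.tsum_le_tsum fun t => mul_le_mul_right (ih t) _
          _ ≤ chainOuter k x E := by
              rw [ENNReal.tsum_mul_right]
              exact mul_le_of_le_one_left zero_le (hk s)
  have hcover : E ⊆ ⋃ n, F n := by
    intro ω hω
    have hv := hvisit ω hω
    exact Set.mem_iUnion.2 ⟨Nat.find hv, hω, fun i hi => Nat.find_min hv hi, Nat.find_spec hv⟩
  refine (measure_mono hcover).trans ((measure_iUnion_le _).trans ?_)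
  rw [ENNReal.tsum_eq_iSup_nat]
  exact iSup_le fun N => hsum N s

theorem chainOuter_infOften_avoid_null (hk : ∀ s, ∑' t, k s t ≤ 1) {x t : S}
    (hxt : 0 < k x t) (s : S) :
    chainOuter k s {ω | ω ∈ evInfOften (· = x) ∧ ∀ i, ω i ≠ t} = 0 := by
  set E : Set (ℕ → S) := {ω | ω ∈ evInfOften (· = x) ∧ ∀ i, ω i ≠ t} with hE
  have hshift : ∀ ω ∈ E, (fun i => ω (i + 1)) ∈ E := by
    rintro ω ⟨h1, h2⟩
    refine ⟨fun n => ?_, fun i => h2 (i + 1)⟩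
    obtain ⟨i, hi, hx⟩ := h1 (n + 1)
    obtain ⟨j, rfl⟩ : ∃ j, i = j + 1 := ⟨i - 1, by omega⟩
    exact ⟨j, by omega, hx⟩
  have hle : ∀ s, chainOuter k s E ≤ chainOuter k x E :=
    chainOuter_le_of_visit hk (fun ω hω => (hω.1 0).imp fun i hi => hi.2) hshift
  have ht : chainOuter k t E = 0 := chainOuter_null_of_start fun ω hω => hω.2 0
  set r : ℝ≥0∞ := ∑' y, if y = t then 0 else k x y with hr
  have hr1 : r < 1 := by
    have hsplit : k x t + r ≤ 1 := by
      rw [hr, ← ENNReal.summable.tsum_eq_add_tsum_ite' t]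
      exact hk x
    have hrfin : r ≠ ∞ := ne_top_of_le_ne_top ENNReal.one_ne_top (le_add_self.trans hsplit)
    exact (ENNReal.lt_add_right hrfin hxt.ne').trans_le (by rwa [add_comm] at hsplit)
  have hx : chainOuter k x E ≤ r * chainOuter k x E := by
    refine (measure_mono hshift).trans ((chainOuter_shift_le hk x E).trans ?_)
    rw [hr, ← ENNReal.tsum_mul_right]
    refine ENNReal.tsum_le_tsum fun y => ?_
    split_ifs with h
    · simp [h, ht]
    · exact mul_le_mul_right (hle y) _
  have hx0 : chainOuter k x E = 0 := by
    by_contra hne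
    have hfin : chainOuter k x E ≠ ∞ :=
      ne_top_of_le_ne_top ENNReal.one_ne_top (chainOuter_le_one x E)
    have := ENNReal.mul_lt_mul_left hne hfin hr1
    rw [one_mul] at this
    exact absurd hx this.not_ge
  exact le_antisymm ((hle s).trans hx0.le) zero_le

/-- Almost surely, a successor of a state visited infinitely often is itself visited
infinitely often. -/
theorem chainOuter_infOften_step_null (hk : ∀ s, ∑' t, k s t ≤ 1) (s : S) :
    chainOuter k s {ω | ∃ x t, 0 < k x t ∧ ω ∈ evInfOften (· = x) ∧
      ω ∉ evInfOften (· = t)} = 0 := by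
  have hsub : {ω : ℕ → S | ∃ x t, 0 < k x t ∧ ω ∈ evInfOften (· = x) ∧
      ω ∉ evInfOften (· = t)} ⊆
      ⋃ p : {p : S × S // 0 < k p.1 p.2}, ⋃ m : ℕ,
        {ω | (fun i => ω (i + m)) ∈
          {ω : ℕ → S | ω ∈ evInfOften (· = p.1.1) ∧ ∀ i, ω i ≠ p.1.2}} := by
    rintro ω ⟨x, t, hxt, hx, ht⟩
    simp only [evInfOften, Set.mem_ofPred_eq, not_forall, not_exists, not_and] at ht
    obtain ⟨m, hm⟩ := ht
    refine Set.mem_iUnion.2 ⟨⟨(x, t), hxt⟩, Set.mem_iUnion.2 ⟨m, fun n => ?_,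
      fun i => hm (i + m) (by omega)⟩⟩
    obtain ⟨i, hi, hx⟩ := hx (n + m)
    obtain ⟨j, rfl⟩ : ∃ j, i = j + m := ⟨i - m, by omega⟩
    exact ⟨j, by omega, hx⟩
  refine measure_mono_null hsub (measure_iUnion_null fun p => measure_iUnion_null fun m => ?_)
  exact chainOuter_shift_null hk (chainOuter_infOften_avoid_null hk p.2) m s

/-- Foster–Lyapunov criterion: if a finite function decays geometrically in expectation outside
`B`, then `B` is almost surely visited infinitely often. -/
theorem chainOuter_not_infOften_null_of_drift (hk : ∀ s, ∑' t, k s t ≤ 1) {B : S → Prop}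
    {V : S → ℝ≥0∞} {r : ℝ≥0∞} (hr : r < 1) (hfin : ∀ s, V s ≠ ∞) (hone : ∀ s, 1 ≤ V s)
    (hdrift : ∀ s, ¬ B s → ∑' t, k s t * V t ≤ r * V s) (s : S) :
    chainOuter k s (evInfOften B)ᶜ = 0 := by
  set E : Set (ℕ → S) := {ω | ∀ i, ¬ B (ω i)} with hE
  have hbound : ∀ n s, chainOuter k s E ≤ r ^ n * V s := by
    intro n
    induction n with
    | zero => exact fun s => by simpa using (chainOuter_le_one s E).trans (hone s)
    | succ n ih =>
      intro s
      by_cases hs : B s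
      · rw [chainOuter_null_of_start (E := E) fun ω hω h => hω 0 (h ▸ hs)]
        exact zero_le
      · refine (measure_mono (s := E) (t := {ω | (fun i => ω (i + 1)) ∈ E})
          fun ω (hω : ω ∈ E) i => hω (i + 1)).trans ((chainOuter_shift_le hk s E).trans ?_)
        calc ∑' t, k s t * chainOuter k t E
            ≤ ∑' t, r ^ n * (k s t * V t) := ENNReal.tsum_le_tsum fun t => by
              rw [mul_left_comm]
              exact mul_le_mul_right (ih t) _
          _ ≤ r ^ (n + 1) * V s := by
              rw [ENNReal.tsum_mul_left, pow_succ, mul_assoc]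
              exact mul_le_mul_right (hdrift s hs) _
  have hE0 : ∀ s, chainOuter k s E = 0 := by
    intro s
    have hlim : Filter.Tendsto (fun n => r ^ n * V s) Filter.atTop (nhds 0) := by
      simpa using ENNReal.Tendsto.mul_const
        (ENNReal.tendsto_pow_atTop_nhds_zero_of_lt_one hr) (Or.inr (hfin s))
    exact le_antisymm (ge_of_tendsto' hlim fun n => hbound n s) zero_le
  have hsub : (evInfOften B)ᶜ ⊆ ⋃ m : ℕ, {ω | (fun i => ω (i + m)) ∈ E} := by
    intro ω hω
    simp only [evInfOften, Set.mem_compl_iff, Set.mem_ofPred_eq, not_forall, not_exists,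
      not_and] at hω
    obtain ⟨m, hm⟩ := hω
    exact Set.mem_iUnion.2 ⟨m, fun i => hm (i + m) (by omega)⟩
  exact measure_mono_null hsub (measure_iUnion_null fun m => chainOuter_shift_null hk hE0 m s)

end ChainLemmas

theorem exists_infOften_eq_of_finite {S : Type} {ω : ℕ → S} {B : Set S} (hB : B.Finite)
    (h : ω ∈ evInfOften (· ∈ B)) : ∃ b ∈ B, ω ∈ evInfOften (· = b) := by
  by_contra! hne
  have hev : ∀ b ∈ B, ∀ᶠ i in Filter.atTop, ω i ≠ b := fun b hb => by
    have := hne b hb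
    simp only [evInfOften, Set.mem_ofPred_eq, not_forall, not_exists, not_and] at this
    exact Filter.eventually_atTop.2 this
  obtain ⟨n, hn⟩ := Filter.eventually_atTop.1 ((Filter.eventually_all_finite hB).2 hev)
  obtain ⟨i, hi, hiB⟩ := h n
  exact hn i hi _ hiB rfl

theorem length_le_of_countEmb_ne_zero {v w : List M}
    (h : countEmb v w ≠ 0) : w.length ≤ v.length := by
  induction v generalizing w with
  | nil => cases w <;> simp_all [countEmb]
  | cons a v ih =>
    cases w with
    | nil => simp
    | cons b w =>
      rw [countEmb] at h
      by_cases hv : countEmb v (b :: w) = 0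
      · have hw : countEmb v w ≠ 0 := fun h0 => h (by simp [hv, h0])
        simpa using ih hw
      · exact (ih hv).trans (by simp)

theorem countEmb_nil_right (v : List M) : countEmb v [] = 1 := by
  cases v <;> rfl

/-- The generating function of the length of a word after losses. -/
theorem tsum_countEmb_le (a b : ℝ≥0∞) (v : List M) :
    ∑' w : List M, a ^ (v.length - w.length) * b ^ w.length * (countEmb v w : ℝ≥0∞)
      ≤ (a + b) ^ v.length := by
  induction v with
  | nil =>
    rw [tsum_eq_single []]
    · simp [countEmb]
    · intro w hw
      cases w <;> simp_all [countEmb]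
  | cons x v ih =>
    set F : List M → ℝ≥0∞ :=
      fun w => a ^ (v.length - w.length) * b ^ w.length * (countEmb v w : ℝ≥0∞) with hF
    have hpt : ∀ w : List M,
        a ^ ((x :: v).length - w.length) * b ^ w.length * (countEmb (x :: v) w : ℝ≥0∞)
          ≤ a * F w + ∑' w', if w = x :: w' then b * F w' else 0 := by
      intro w
      cases w with
      | nil =>
        refine le_trans (le_of_eq ?_) le_self_add
        simp [hF, countEmb_nil_right, pow_succ']
      | cons y w =>
        rw [countEmb, Nat.cast_add, mul_add, add_comm]
        refine add_le_add ?_ ?_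
        · by_cases h0 : countEmb v (y :: w) = 0
          · simp [h0]
          · have hlen := length_le_of_countEmb_ne_zero h0
            refine le_of_eq ?_
            have : (x :: v).length - (y :: w).length = v.length - (y :: w).length + 1 := by
              simp only [List.length_cons] at hlen ⊢
              omega
            rw [this]
            simp only [hF]
            ring
        · by_cases hxy : x = y
          · subst hxy
            refine le_trans (le_of_eq ?_) (ENNReal.le_tsum w)
            simp only [hF, if_true, List.length_cons, Nat.add_sub_add_right]
            ring
          · simp [hxy]
    calc _ ≤ ∑' w, (a * F w + ∑' w', if w = x :: w' then b * F w' else 0) :=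
          ENNReal.tsum_le_tsum hpt
      _ = a * ∑' w, F w + b * ∑' w, F w := by
          rw [ENNReal.tsum_add, ENNReal.tsum_mul_left, ENNReal.tsum_comm]
          simp only [tsum_ite_eq, ENNReal.tsum_mul_left]
      _ ≤ (a + b) ^ (x :: v).length := by
          rw [← add_mul, List.length_cons, pow_succ']
          exact mul_le_mul_right ih _

theorem tsum_pi_prod_le {ι α : Type} [Fintype ι] (g : ι → α → ℝ≥0∞) :
    ∑' w : ι → α, ∏ i, g i (w i) ≤ ∏ i, ∑' x, g i x := by
  rw [ENNReal.tsum_eq_iSup_sum]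
  refine iSup_le fun s => ?_
  calc ∑ w ∈ s, ∏ i, g i (w i)
      ≤ ∑ w ∈ Fintype.piFinset fun i => s.image fun w => w i, ∏ i, g i (w i) :=
        Finset.sum_le_sum_of_subset fun w hw =>
          Fintype.mem_piFinset.2 fun i => Finset.mem_image_of_mem _ hw
    _ = ∏ i, ∑ x ∈ s.image fun w => w i, g i x := (Finset.prod_univ_sum _ _).symm
    _ ≤ ∏ i, ∑' x, g i x := Finset.prod_le_prod' fun i _ => ENNReal.sum_le_tsum _

theorem plost_le_prod {C M : Type} [Fintype C] [DecidableEq M] {τ : ℝ}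
    (h0 : 0 ≤ τ) (h1 : τ ≤ 1) (v w : Chans C M) :
    plost τ v w ≤ ∏ c, (ENNReal.ofReal τ ^ ((v c).length - (w c).length) *
      ENNReal.ofReal (1 - τ) ^ (w c).length * (countEmb (v c) (w c) : ℝ≥0∞)) := by
  by_cases hz : ∏ c, countEmb (v c) (w c) = 0
  · simp only [plost, hz, Nat.cast_zero, mul_zero, ENNReal.ofReal_zero, zero_le]
  · have hlen : ∀ c ∈ Finset.univ, (w c).length ≤ (v c).length := fun c hc =>
      length_le_of_countEmb_ne_zero (Finset.prod_ne_zero_iff.1 hz c hc)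
    have hsub : chansSize v - chansSize w = ∑ c, ((v c).length - (w c).length) :=
      (Finset.sum_tsub_distrib _ hlen).symm
    have h1' : 0 ≤ 1 - τ := sub_nonneg.2 h1
    rw [plost, hsub, chansSize, ENNReal.ofReal_mul (by positivity), ENNReal.ofReal_mul
      (by positivity), ENNReal.ofReal_pow h0, ENNReal.ofReal_pow h1', ENNReal.ofReal_natCast,
      Finset.prod_mul_distrib, Finset.prod_mul_distrib, Finset.prod_pow_eq_pow_sum,
      Finset.prod_pow_eq_pow_sum, Nat.cast_prod]

theorem tsum_plost_mul_pow_le {C M : Type} [Fintype C] [DecidableEq M] {τ : ℝ}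
    (h0 : 0 ≤ τ) (h1 : τ ≤ 1) (z : ℝ≥0∞) (v : Chans C M) :
    ∑' w, plost τ v w * z ^ chansSize w ≤
      (ENNReal.ofReal τ + ENNReal.ofReal (1 - τ) * z) ^ chansSize v := by
  set a := ENNReal.ofReal τ
  set b := ENNReal.ofReal (1 - τ)
  calc ∑' w, plost τ v w * z ^ chansSize w
      ≤ ∑' w : Chans C M, ∏ c, (a ^ ((v c).length - (w c).length) * (b * z) ^ (w c).length *
          (countEmb (v c) (w c) : ℝ≥0∞)) := by
        refine ENNReal.tsum_le_tsum fun w => ?_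
        refine (mul_le_mul_left (plost_le_prod h0 h1 v w) _).trans (le_of_eq ?_)
        rw [chansSize, ← Finset.prod_pow_eq_pow_sum, ← Finset.prod_mul_distrib]
        refine Finset.prod_congr rfl fun c _ => ?_
        rw [mul_pow]
        ring
    _ ≤ ∏ c, ∑' x : List M, a ^ ((v c).length - x.length) * (b * z) ^ x.length *
          (countEmb (v c) x : ℝ≥0∞) :=
        tsum_pi_prod_le fun c x =>
          a ^ ((v c).length - x.length) * (b * z) ^ x.length * (countEmb (v c) x : ℝ≥0∞)
    _ ≤ ∏ c, (a + b * z) ^ (v c).length :=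
        Finset.prod_le_prod' fun c _ => tsum_countEmb_le a (b * z) (v c)
    _ = (a + b * z) ^ chansSize v := Finset.prod_pow_eq_pow_sum _ _ _

theorem plost_eps_pos {C M : Type} [Fintype C] [DecidableEq M] {τ : ℝ}
    (h0 : 0 < τ) (v : Chans C M) :
    0 < plost τ v (eps C M) := by
  simp only [plost, eps, countEmb_nil_right, chansSize, List.length_nil,
    Finset.sum_const_zero, Finset.prod_const_one]
  simpa using pow_pos h0 _

theorem chansSize_applyOp_le {C M : Type} [Fintype C] [DecidableEq C]
    (op : LcsOp C M) (w : Chans C M) :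
    chansSize (applyOp op w) ≤ chansSize w + 1 := by
  have hupd : ∀ c l, l.length ≤ (w c).length + 1 →
      chansSize (Function.update w c l) ≤ chansSize w + 1 := by
    intro c l hl
    simp only [chansSize]
    rw [← Finset.add_sum_erase _ _ (Finset.mem_univ c),
      ← Finset.add_sum_erase _ (fun c => (w c).length) (Finset.mem_univ c),
      Finset.sum_congr rfl fun d hd => by
        rw [Function.update_of_ne (Finset.ne_of_mem_erase hd)]]
    simp only [Function.update_self]
    omega
  cases op with
  | send c m => exact hupd _ _ (by simp)
  | recv c m => exact hupd _ _ (by simp only [List.length_tail]; omega)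
  | internal => exact Nat.le_succ _

theorem FMScheduler.tsum_kernel_mul_pow_le (fm : FMScheduler N) (z : ℝ≥0∞)
    (s : Conf Q C M × fm.Mode) :
    ∑' t, fm.kernel s t * z ^ chansSize t.1.2 ≤
      (ENNReal.ofReal N.τ + ENNReal.ofReal (1 - N.τ) * z) ^
        chansSize (applyOp (fm.D s.2 s.1).op s.1.2) := by
  set v := applyOp (fm.D s.2 s.1).op s.1.2
  refine le_trans ?_ (tsum_plost_mul_pow_le N.τ_pos.le N.τ_lt_one.le z v)
  have hpt : ∀ t : Conf Q C M × fm.Mode, fm.kernel s t * z ^ chansSize t.1.2 ≤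
      ∑' w, if t = (((fm.D s.2 s.1).dst, w), fm.upd s.2 s.1) then
        plost N.τ v w * z ^ chansSize w else 0 := by
    rintro ⟨⟨r, w⟩, m⟩
    refine le_trans ?_ (ENNReal.le_tsum w)
    simp only [FMScheduler.kernel, NPLCS.stepProb]
    split_ifs <;> simp_all [v]
  refine (ENNReal.tsum_le_tsum hpt).trans (le_of_eq ?_)
  rw [ENNReal.tsum_comm]
  simp only [tsum_ite_eq]

theorem FMScheduler.tsum_kernel_le_one (fm : FMScheduler N) (s : Conf Q C M × fm.Mode) :
    ∑' t, fm.kernel s t ≤ 1 := by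
  have hτ : ENNReal.ofReal N.τ + ENNReal.ofReal (1 - N.τ) = 1 := by
    rw [← ENNReal.ofReal_add N.τ_pos.le (sub_nonneg.2 N.τ_lt_one.le)]
    simp
  simpa [hτ] using fm.tsum_kernel_mul_pow_le 1 s

theorem FMScheduler.kernel_eps_pos (fm : FMScheduler N) {s t : Conf Q C M × fm.Mode}
    (h : 0 < fm.kernel s t) : 0 < fm.kernel s ((t.1.1, eps C M), t.2) := by
  simp only [FMScheduler.kernel, NPLCS.stepProb] at h ⊢
  split_ifs at h ⊢ with h1 h2
  · exact plost_eps_pos N.τ_pos _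
  all_goals simp_all

theorem finite_chansSize_le {Q C M : Type} [Fintype C] [Finite Q] [Finite M] (K : ℕ) (Mode : Type)
    [Finite Mode] :
    {s : Conf Q C M × Mode | chansSize s.1.2 ≤ K}.Finite := by
  have hlist : {l : List M | l.length ≤ K}.Finite := List.finite_length_le M K
  have hpi : (Set.univ.pi fun _ : C => {l : List M | l.length ≤ K}).Finite :=
    Set.Finite.pi fun _ => hlist
  refine ((Set.finite_univ.prod hpi).prod Set.finite_univ).subset ?_
  intro s hs
  refine ⟨⟨trivial, fun c _ => ?_⟩, trivial⟩
  exact (Finset.single_le_sum (f := fun c => (s.1.2 c).length)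
    (fun _ _ => Nat.zero_le _) (Finset.mem_univ c)).trans hs

/-- The configurations with few messages form an attractor. -/
theorem FMScheduler.exists_attractor [Finite Q] [Finite M] (fm : FMScheduler N) :
    ∃ K, ∀ s, chainOuter fm.kernel s
      (evInfOften fun t : Conf Q C M × fm.Mode => chansSize t.1.2 ≤ K)ᶜ = 0 := by
  have := fm.modeFin
  have hτ0 := N.τ_pos
  have hτ1 := N.τ_lt_one
  have hlim : Filter.Tendsto (fun n : ℕ => ((2 - N.τ) / 2) ^ n) Filter.atTop (nhds 0) :=
    tendsto_pow_atTop_nhds_zero_of_lt_one (by linarith) (by linarith)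
  obtain ⟨K, hK⟩ := Filter.eventually_atTop.1 (hlim.eventually_lt_const
    (show (0 : ℝ) < 1 / 4 by norm_num))
  refine ⟨K, chainOuter_not_infOften_null_of_drift (V := fun t => 2 ^ chansSize t.1.2)
    (r := ENNReal.ofReal (1 / 2)) fm.tsum_kernel_le_one ?_ (fun s => by simp)
    (fun s => one_le_pow₀ one_le_two) fun s hs => ?_⟩
  · rw [ENNReal.ofReal_lt_one]
    norm_num
  · refine (fm.tsum_kernel_mul_pow_le 2 s).trans ?_
    have h2 : ENNReal.ofReal N.τ + ENNReal.ofReal (1 - N.τ) * 2 = ENNReal.ofReal (2 - N.τ) := by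
      rw [show (2 : ℝ≥0∞) = ENNReal.ofReal 2 by simp, ← ENNReal.ofReal_mul (by linarith),
        ← ENNReal.ofReal_add hτ0.le (by linarith)]
      congr 1
      ring
    rw [h2, show (2 : ℝ≥0∞) = ENNReal.ofReal 2 by simp, ← ENNReal.ofReal_pow (by linarith),
      ← ENNReal.ofReal_pow (by norm_num), ← ENNReal.ofReal_mul (by norm_num)]
    refine ENNReal.ofReal_le_ofReal ?_
    set n := chansSize s.1.2
    calc (2 - N.τ) ^ chansSize (applyOp (fm.D s.2 s.1).op s.1.2)
        ≤ (2 - N.τ) ^ (n + 1) := pow_le_pow_right₀ (by linarith) (chansSize_applyOp_le _ _)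
      _ = (2 - N.τ) * (((2 - N.τ) / 2) ^ n * 2 ^ n) := by
          rw [← mul_pow, div_mul_cancel₀ _ two_ne_zero, pow_succ']
      _ ≤ 2 * (1 / 4 * 2 ^ n) := by
          have := (hK n (not_le.1 hs).le).le
          gcongr
          · have : 0 < 2 - N.τ := by linarith
            positivity
          · linarith
      _ = 1 / 2 * 2 ^ n := by ring

theorem FMScheduler.PrMC_eq_of_subset (fm : FMScheduler N) {s : Conf Q C M × fm.Mode}
    {E F Z : Set (ℕ → Conf Q C M × fm.Mode)} (hFE : F ⊆ E) (hEF : E ⊆ F ∪ Z)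
    (hZ : chainOuter fm.kernel s Z = 0) : fm.PrMC s E = fm.PrMC s F := by
  simp only [FMScheduler.PrMC, ← chainOuter_apply]
  refine le_antisymm ?_ (MeasureTheory.measure_mono hFE)
  exact (MeasureTheory.measure_mono hEF).trans
    ((MeasureTheory.measure_union_le _ _).trans (by rw [hZ, add_zero]))

/-- Basic properties of finite-memory schedulers: (a) in the Markov chain
`MC_U`, visiting the state `(p,ε)_u` infinitely often has the same probability
as visiting every state reachable from `(p,ε)_u` infinitely often;
(b) `□◇A` and `□◇A_ε` have the same probability. -/
theorem statement13 {Q C M : Type} [Fintype Q] [Fintype C] [DecidableEq C]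
    [Fintype M] [DecidableEq M] {N : NPLCS Q C M} (fm : FMScheduler N)
    (q p : Q) (u : fm.Mode) (A : Set Q) :
    (fm.PrMC ((q, eps C M), fm.init)
        (evInfOften (fun a => a = ((p, eps C M), u)))
      = fm.PrMC ((q, eps C M), fm.init)
        {ω | ∀ t, fm.MCReach ((p, eps C M), u) t →
              ∀ m, ∃ i, m ≤ i ∧ ω i = t})
    ∧ (fm.PrMC ((q, eps C M), fm.init)
        (evInfOften (fun a : Conf Q C M × fm.Mode => a.1.1 ∈ A))
      = fm.PrMC ((q, eps C M), fm.init)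
        (evInfOften (fun a : Conf Q C M × fm.Mode =>
          a.1.1 ∈ A ∧ a.1.2 = eps C M))) := by
  have := fm.modeFin
  have hstep := chainOuter_infOften_step_null fm.tsum_kernel_le_one ((q, eps C M), fm.init)
  constructor
  · refine fm.PrMC_eq_of_subset (fun ω hω => hω _ Relation.ReflTransGen.refl)
      (fun ω hω => or_iff_not_imp_right.2 fun hz t ht => ?_) hstep
    refine infOften_of_reach (k := fm.kernel) (fun x t hxt hx => ?_) hω ht
    by_contra hnot
    exact hz ⟨x, t, hxt, hx, hnot⟩
  · obtain ⟨K, hK⟩ := fm.exists_attractor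
    refine fm.PrMC_eq_of_subset (fun ω hω n => (hω n).imp fun i hi => ⟨hi.1, hi.2.1⟩)
      (fun ω hω => or_iff_not_imp_right.2 fun hz => ?_)
      (MeasureTheory.measure_union_null (MeasureTheory.measure_union_null hstep
        (chainOuter_zero_step_null fm.tsum_kernel_le_one _)) (hK _))
    simp only [Set.mem_union, not_or, Set.mem_compl_iff, not_not] at hz
    obtain ⟨⟨hsucc, hpos⟩, hatt⟩ := hz
    have hsucc' : ∀ x t, 0 < fm.kernel x t → ω ∈ evInfOften (· = x) →
        ω ∈ evInfOften (· = t) := fun x t hxt hx => by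
      by_contra hnot
      exact hsucc ⟨x, t, hxt, hx, hnot⟩
    have hpos' : ∀ i, 0 < fm.kernel (ω i) (ω (i + 1)) := fun i =>
      pos_iff_ne_zero.2 fun h => hpos ⟨i, h⟩
    obtain ⟨b, -, hb⟩ := exists_infOften_eq_of_finite (finite_chansSize_le K fm.Mode) hatt
    obtain ⟨i, -, rfl⟩ := hb 0
    obtain ⟨j, hij, hjA⟩ := hω (i + 1)
    obtain ⟨d, rfl⟩ : ∃ d, j = i + d + 1 := ⟨j - i - 1, by omega⟩
    have hreach : ∀ d, ω ∈ evInfOften (· = ω (i + d)) := by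
      intro d
      induction d with
      | zero => exact hb
      | succ d ih => exact hsucc' _ _ (hpos' _) ih
    intro n
    obtain ⟨l, hl, heq⟩ := hsucc' _ _ (fm.kernel_eps_pos (hpos' (i + d))) (hreach d) n
    refine ⟨l, hl, ?_⟩
    rw [heq]
    exact ⟨hjA, rfl⟩

end NPLCSmodel
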